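/- (Proposition 1 in density form, exchangeable case: well-posedness of the replicator dynamic (10).) Let E = L¹(Ω, λ) be the space of (equivalence classes of) Lebesgue-integrable real functions on Ω with the L¹ norm, where λ is Lebesgue measure on Ω. Let Ū > 0, L_U > 0, and let U : Ω × E → ℝ satisfy: 0 ≤ U(x, p) ≤ Ū for all x ∈ Ω and p ∈ E; |U(x, p) − U(x, q)| ≤ L_U ‖p − q‖_{L¹} for all x ∈ Ω and p, q ∈ E; and x ↦ U(x, p) is Borel measurable for every p ∈ E. For q ∈ E define G(q) ∈ E by G(q)(x) = (U(x, q) − ∫_Ω U(z, q) q(z) λ(dz)) · q(x). Then for every p₀ ∈ E with p₀ ≥ 0 λ-almost everywhere and ∫_Ω p₀ dλ = 1, and every T > 0, there exists a unique continuous curve p : [0, T] → E with p(0) = p₀ that is differentiable at every t ∈ [0, T] (one-sided at the endpoints) with derivative p'(t) = G(p(t)) in E; moreover, for every t ∈ [0, T], p(t) ≥ 0 λ-almost everywhere and ∫_Ω p(t) dλ = 1. -/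

import Mathlib

open MeasureTheory

/-- The action space `Ω = [0,1] ⊆ ℝ`, with its Borel σ-algebra and the
Lebesgue measure `volume`. -/
abbrev Ω : Type := Set.Icc (0:ℝ) 1

/-- The Banach space `E = L¹(Ω, λ)`. -/
noncomputable abbrev E : Type := Lp ℝ 1 (volume : Measure Ω)

open Set in
theorem relax_exists {X : Type*} [NormedAddCommGroup X] [NormedSpace ℝ X] [CompleteSpace X]
    (Φ : X → X) (K B : NNReal) (hΦ : LipschitzWith K Φ) (hB : ∀ x, ‖Φ x‖ ≤ B)
    (c : ℝ) (hc : 0 < c) (x₀ : X) (T : ℝ) (hT : 0 < T) :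
    ∃ p : ℝ → X, p 0 = x₀ ∧
      ∀ t ∈ Icc (0:ℝ) T, HasDerivWithinAt p (c • (Φ (p t) - p t)) (Icc 0 T) t := by
  let f : ℝ → X → X := fun t u => (c * Real.exp (c * t)) • Φ (Real.exp (-(c * t)) • u)
  let L : NNReal := ⟨c * Real.exp (c * T) * B, by positivity⟩
  let a : NNReal := ⟨L * T, by positivity⟩
  let K' : NNReal := ⟨c * K, by positivity⟩
  have hPL : IsPicardLindelof f (tmin := 0) (tmax := T) ⟨0, by simp [hT.le]⟩ x₀ a 0 L K' := by
    refine ⟨?_, ?_, ?_, ?_⟩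
    · intro t ht
      apply LipschitzWith.lipschitzOnWith
      apply LipschitzWith.of_dist_le_mul
      intro x y
      have h1 := hΦ.dist_le_mul (Real.exp (-(c * t)) • x) (Real.exp (-(c * t)) • y)
      simp only [f, dist_smul₀] at h1 ⊢
      rw [Real.norm_of_nonneg (by positivity)] at h1 ⊢
      calc c * Real.exp (c * t) * _ ≤ c * Real.exp (c * t) * 
            (K * (Real.exp (-(c * t)) * dist x y)) := by gcongr
        _ = c * K * dist x y * (Real.exp (c * t) * Real.exp (-(c * t))) := by ring
        _ = c * K * dist x y := by rw [← Real.exp_add]; simp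
    · intro x _
      have := hΦ.continuous
      apply Continuous.continuousOn
      fun_prop
    · intro t ht x _
      simp only [f, norm_smul]
      rw [Real.norm_of_nonneg (by positivity)]
      change _ ≤ c * Real.exp (c * T) * B
      gcongr
      · exact ht.2
      · exact hB _
    · simp [a, hT.le]
      exact le_rfl
  obtain ⟨u, hu0, hu⟩ := hPL.exists_eq_forall_mem_Icc_hasDerivWithinAt₀
  refine ⟨fun t => Real.exp (-(c * t)) • u t, by simpa using hu0, fun t ht => ?_⟩
  have h1 : HasDerivWithinAt (fun t : ℝ => Real.exp (-(c * t)))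
      (Real.exp (-(c * t)) * (-(c * 1))) (Icc 0 T) t :=
    (((hasDerivAt_id t).const_mul c).neg.exp).hasDerivWithinAt
  have h2 := h1.smul (hu t ht)
  refine h2.congr_deriv ?_
  simp only [f]
  symm
  rw [smul_smul, smul_sub, smul_smul, sub_eq_add_neg, ← neg_smul]
  congr 2
  · rw [mul_left_comm, ← Real.exp_add]; simp
  · ring

open Set in
theorem relax_mem {X : Type*} [NormedAddCommGroup X] [NormedSpace ℝ X]
    (D : Set X) (hD : Convex ℝ D) (hDc : IsClosed D)
    (Φ : X → X) (hΦ : ∀ x, Φ x ∈ D)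
    (c : ℝ) (hc : 0 < c) (T : ℝ) (p : ℝ → X) (h0 : p 0 ∈ D)
    (hp : ∀ t ∈ Icc (0:ℝ) T, HasDerivWithinAt p (c • (Φ (p t) - p t)) (Icc 0 T) t) :
    ∀ t ∈ Icc (0:ℝ) T, p t ∈ D := by
  intro t ht
  by_contra hn
  obtain ⟨l, s, hl, hs⟩ := geometric_hahn_banach_closed_point hD hDc hn
  have hder : ∀ r ∈ Icc (0:ℝ) T, HasDerivWithinAt (fun r => Real.exp (c * r) * (l (p r) - s))
      (Real.exp (c * r) * (c * 1) * (l (p r) - s)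
        + Real.exp (c * r) * (l (c • (Φ (p r) - p r)))) (Icc 0 T) r := by
    intro r hr
    have h1 : HasDerivWithinAt (fun t : ℝ => Real.exp (c * t))
      (Real.exp (c * r) * (c * 1)) (Icc 0 T) r :=
      (((hasDerivAt_id r).const_mul c).exp).hasDerivWithinAt
    exact h1.mul ((l.hasFDerivAt.comp_hasDerivWithinAt r (hp r hr)).sub_const s)
  have hanti : AntitoneOn (fun r => Real.exp (c * r) * (l (p r) - s)) (Icc 0 T) := by
    refine antitoneOn_of_hasDerivWithinAt_nonpos (convex_Icc 0 T)
      (fun r hr => (hder r hr).continuousWithinAt)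
      (fun r hr => (hder r (interior_subset hr)).mono interior_subset) ?_
    intro r hr
    have := hl _ (hΦ (p r))
    rw [map_smul, map_sub, smul_eq_mul]
    have e : Real.exp (c * r) * (c * 1) * (l (p r) - s)
      + Real.exp (c * r) * (c * (l (Φ (p r)) - l (p r)))
      = Real.exp (c * r) * c * (l (Φ (p r)) - s) := by ring
    rw [e]
    exact mul_nonpos_of_nonneg_of_nonpos (by positivity) (by linarith)
  have h := hanti ⟨le_rfl, ht.1.trans ht.2⟩ ht ht.1
  have h00 := hl _ h0
  have : 0 < Real.exp (c * t) * (l (p t) - s) := mul_pos (Real.exp_pos _) (by linarith)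
  simp at h
  linarith

theorem smulE_nonneg {a : ℝ} (ha : 0 ≤ a) {q : E} (hq : 0 ≤ q) : 0 ≤ a • q := by
  rw [← Lp.coeFn_nonneg] at hq ⊢
  filter_upwards [hq, Lp.coeFn_smul a q] with x h1 h2
  rw [h2, Pi.smul_apply, smul_eq_mul]
  exact mul_nonneg ha h1

/-- total mass, as a continuous linear functional -/
noncomputable def massL : E →L[ℝ] ℝ := L1.integralCLM

theorem massL_apply (q : E) : massL q = ∫ x, (q : Ω → ℝ) x ∂(volume : Measure Ω) := by
  rw [← L1.integral_eq_integral, L1.integral_eq]; rfl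

theorem abs_massL_le (q : E) : |massL q| ≤ ‖q‖ := by
  have := L1.norm_integral_le q
  rw [L1.integral_eq] at this
  exact this

theorem norm_eq_massL {q : E} (hq : 0 ≤ q) : ‖q‖ = massL q := by
  rw [massL_apply, L1.norm_eq_integral_norm]
  apply integral_congr_ae
  filter_upwards [(Lp.coeFn_nonneg q).2 hq] with x hx
  exact Real.norm_of_nonneg hx

/-- the set of densities -/
def densSet : Set E := {q | 0 ≤ q ∧ massL q = 1}

theorem convex_densSet : Convex ℝ densSet := by
  intro x hx y hy a b ha hb hab
  refine ⟨add_nonneg (smulE_nonneg ha hx.1) (smulE_nonneg hb hy.1), ?_⟩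
  simp [hx.2, hy.2, hab]

theorem isClosed_densSet : IsClosed densSet :=
  (isClosed_Ici (a := (0 : E))).inter (isClosed_eq massL.continuous continuous_const)

/-- the uniform density -/
noncomputable def oneE : E := Lp.const 1 volume (1 : ℝ)

theorem oneE_mem : oneE ∈ densSet := by
  have h := Lp.coeFn_const (α := Ω) (p := 1) (μ := volume) (c := (1 : ℝ))
  constructor
  · rw [← Lp.coeFn_nonneg]
    filter_upwards [h] with x hx
    simp only [oneE]
    rw [hx]; simp
  · rw [massL_apply]
    simp only [oneE]
    rw [integral_congr_ae h]
    simp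

theorem norm_oneE : ‖oneE‖ = 1 := by rw [norm_eq_massL oneE_mem.1, oneE_mem.2]

/-- unnormalized retraction -/
noncomputable def preRet (q : E) : E := q⁺ + (max 0 (1 - massL q⁺)) • oneE

theorem preRet_nonneg (q : E) : 0 ≤ preRet q :=
  add_nonneg (posPart_nonneg q) (smulE_nonneg (le_max_left _ _) oneE_mem.1)

theorem massL_preRet (q : E) : massL (preRet q) = max 1 (massL q⁺) := by
  simp only [preRet, map_add, map_smul, oneE_mem.2, smul_eq_mul, mul_one]
  rcases le_total (massL q⁺) 1 with h | h
  · rw [max_eq_right (by linarith), max_eq_left h]; ring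
  · rw [max_eq_left (by linarith), max_eq_right h]; ring

/-- Lipschitz retraction onto the densities -/
noncomputable def ret (q : E) : E := (max 1 (massL q⁺))⁻¹ • preRet q

theorem ret_mem (q : E) : ret q ∈ densSet := by
  have : 0 < max 1 (massL q⁺) := lt_of_lt_of_le one_pos (le_max_left _ _)
  refine ⟨smulE_nonneg (by positivity) (preRet_nonneg q), ?_⟩
  simp only [ret, map_smul, massL_preRet, smul_eq_mul]
  exact inv_mul_cancel₀ this.ne'

theorem ret_of_mem {q : E} (hq : q ∈ densSet) : ret q = q := by
  have h : q⁺ = q := posPart_of_nonneg hq.1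
  simp [ret, preRet, h, hq.2]

theorem massL_pos_sub (q r : E) : |massL q⁺ - massL r⁺| ≤ ‖q - r‖ := by
  rw [← map_sub]
  refine (abs_massL_le _).trans ?_
  have := (lipschitzWith_posPart (α := E)).dist_le_mul q r
  simpa [dist_eq_norm] using this

theorem ret_lip (q r : E) : ‖ret q - ret r‖ ≤ 3 * ‖q - r‖ := by
  have hm := massL_pos_sub q r
  have hp : ‖q⁺ - r⁺‖ ≤ ‖q - r‖ := by
    have := (lipschitzWith_posPart (α := E)).dist_le_mul q r
    simpa [dist_eq_norm] using this
  have hpre : ‖preRet q - preRet r‖ ≤ 2 * ‖q - r‖ := by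
    have e : preRet q - preRet r = (q⁺ - r⁺)
        + (max 0 (1 - massL q⁺) - max 0 (1 - massL r⁺)) • oneE := by
      simp only [preRet, sub_smul]; abel
    rw [e]
    refine (norm_add_le _ _).trans ?_
    rw [norm_smul, norm_oneE, Real.norm_eq_abs, mul_one]
    have := abs_max_sub_max_le_max 0 (1 - massL q⁺) 0 (1 - massL r⁺)
    have h2 : |(1 - massL q⁺) - (1 - massL r⁺)| = |massL q⁺ - massL r⁺| := by
      rw [abs_sub_comm]; congr 1; ring
    rw [h2] at this
    have h3 : max |(0:ℝ) - 0| |massL q⁺ - massL r⁺| = |massL q⁺ - massL r⁺| := by simp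
    linarith
  have hn : ‖preRet r‖ = max 1 (massL r⁺) := by
    rw [norm_eq_massL (preRet_nonneg r), massL_preRet]
  have hs : 1 ≤ max 1 (massL q⁺) := le_max_left _ _
  have ht : 1 ≤ max 1 (massL r⁺) := le_max_left _ _
  have hst : |max 1 (massL r⁺) - max 1 (massL q⁺)| ≤ ‖q - r‖ := by
    have := abs_max_sub_max_le_max 1 (massL r⁺) 1 (massL q⁺)
    rw [abs_sub_comm (massL r⁺)] at this
    have h3 : max |(1:ℝ) - 1| |massL q⁺ - massL r⁺| = |massL q⁺ - massL r⁺| := by simp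
    linarith
  simp only [ret]
  rw [← hn] at *
  set s := max 1 (massL q⁺)
  set y := preRet r
  set x := preRet q
  have e : s⁻¹ • x - ‖y‖⁻¹ • y = s⁻¹ • (x - y) + (s⁻¹ - ‖y‖⁻¹) • y := by
    rw [smul_sub, sub_smul]; abel
  have hinv : s⁻¹ ≤ 1 := inv_le_one_of_one_le₀ hs
  have hinv0 : 0 ≤ s⁻¹ := by positivity
  have e2 : |s⁻¹ - ‖y‖⁻¹| * ‖y‖ = s⁻¹ * |‖y‖ - s| := by
    have : s⁻¹ - ‖y‖⁻¹ = s⁻¹ * (‖y‖ - s) * ‖y‖⁻¹ := by field_simp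
    rw [this, abs_mul, abs_mul, abs_of_nonneg hinv0, abs_of_nonneg (inv_nonneg.2 (norm_nonneg y))]
    field_simp
  rw [e]
  refine (norm_add_le _ _).trans ?_
  rw [norm_smul, norm_smul, Real.norm_eq_abs, Real.norm_eq_abs, e2, abs_of_nonneg hinv0]
  have h1 := mul_le_mul hinv hpre (norm_nonneg _) zero_le_one
  have h2 := mul_le_mul hinv hst (abs_nonneg _) zero_le_one
  linarith

section field

variable {Ubar LU : ℝ} {U : Ω → E → ℝ}

theorem integrable_Uq (hUb : ∀ (x : Ω) (p : E), 0 ≤ U x p ∧ U x p ≤ Ubar)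
    (hUm : ∀ p : E, Measurable fun x => U x p) (q : E) :
    Integrable (fun x => U x q * (q : Ω → ℝ) x) (volume : Measure Ω) := by
  refine (L1.integrable_coeFn q).bdd_mul (c := Ubar) (hUm q).aestronglyMeasurable ?_
  refine Filter.Eventually.of_forall fun x => ?_
  rw [Real.norm_of_nonneg (hUb x q).1]
  exact (hUb x q).2

theorem exists_A (hUb : ∀ (x : Ω) (p : E), 0 ≤ U x p ∧ U x p ≤ Ubar)
    (hUm : ∀ p : E, Measurable fun x => U x p) :
    ∃ A : E → E, ∀ q : E, ∀ᵐ x ∂(volume : Measure Ω),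
      (A q : Ω → ℝ) x = U x q * (q : Ω → ℝ) x :=
  ⟨fun q => (integrable_Uq hUb hUm q).toL1 _, fun q => Integrable.coeFn_toL1 _⟩

variable {A : E → E} (hA : ∀ q : E, ∀ᵐ x ∂(volume : Measure Ω),
      (A q : Ω → ℝ) x = U x q * (q : Ω → ℝ) x)

include hA

theorem norm_A_le (hUb : ∀ (x : Ω) (p : E), 0 ≤ U x p ∧ U x p ≤ Ubar) (q : E) :
    ‖A q‖ ≤ Ubar * ‖q‖ := by
  apply Lp.norm_le_mul_norm_of_ae_le_mul
  filter_upwards [hA q] with x hx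
  rw [hx, norm_mul, Real.norm_of_nonneg (hUb x q).1]
  exact mul_le_mul_of_nonneg_right (hUb x q).2 (norm_nonneg _)

theorem A_lip (hUbar : 0 < Ubar) (hLU : 0 < LU)
    (hUb : ∀ (x : Ω) (p : E), 0 ≤ U x p ∧ U x p ≤ Ubar)
    (hULip : ∀ (x : Ω) (p q : E), |U x p - U x q| ≤ LU * ‖p - q‖) (q r : E) :
    ‖A q - A r‖ ≤ (Ubar + LU * ‖r‖) * ‖q - r‖ := by
  have h : ‖A q - A r‖ ≤ ‖Ubar • |q - r| + (LU * ‖q - r‖) • |r|‖ := by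
    apply Lp.norm_le_norm_of_ae_le
    filter_upwards [hA q, hA r, Lp.coeFn_sub (A q) (A r), Lp.coeFn_sub q r,
      Lp.coeFn_abs (q - r), Lp.coeFn_abs r, Lp.coeFn_smul Ubar |q - r|,
      Lp.coeFn_smul (LU * ‖q - r‖) |r|,
      Lp.coeFn_add (Ubar • |q - r|) ((LU * ‖q - r‖) • |r|)] with x h1 h2 h3 h4 h5 h6 h7 h8 h9
    rw [h3, h9]
    simp only [Pi.sub_apply, Pi.add_apply, Pi.smul_apply, smul_eq_mul, h1, h2, h7, h8, h5, h6, h4]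
    have hl := hULip x q r
    have hu := hUb x q
    rw [Real.norm_eq_abs, Real.norm_eq_abs]
    refine le_trans ?_ (le_abs_self _)
    have e : U x q * (q : Ω → ℝ) x - U x r * (r : Ω → ℝ) x
      = U x q * ((q : Ω → ℝ) x - (r : Ω → ℝ) x) + (U x q - U x r) * (r : Ω → ℝ) x := by ring
    rw [e]
    refine (abs_add_le _ _).trans ?_
    rw [abs_mul, abs_mul, abs_of_nonneg hu.1]
    exact add_le_add (mul_le_mul_of_nonneg_right hu.2 (abs_nonneg _))
      (mul_le_mul_of_nonneg_right hl (abs_nonneg _))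
  refine h.trans ((norm_add_le _ _).trans ?_)
  rw [norm_smul, norm_smul, norm_abs_eq_norm, norm_abs_eq_norm, Real.norm_of_nonneg hUbar.le,
    Real.norm_of_nonneg (by positivity)]
  exact le_of_eq (by ring)

theorem G_eq {G : E → E} (hG : ∀ q : E, ∀ᵐ x ∂(volume : Measure Ω),
      (G q : Ω → ℝ) x = (U x q - ∫ z, U z q * (q : Ω → ℝ) z ∂(volume : Measure Ω)) *
        (q : Ω → ℝ) x) (q : E) : G q = A q - massL (A q) • q := by
  apply Lp.ext
  have hm : massL (A q) = ∫ z, U z q * (q : Ω → ℝ) z ∂(volume : Measure Ω) := by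
    rw [massL_apply]; exact integral_congr_ae (hA q)
  filter_upwards [hG q, hA q, Lp.coeFn_sub (A q) (massL (A q) • q),
    Lp.coeFn_smul (massL (A q)) q] with x h1 h2 h3 h4
  rw [h1, h3, Pi.sub_apply, h2, h4, Pi.smul_apply, hm, smul_eq_mul]
  ring

theorem G_lip {G : E → E} (hGA : ∀ q, G q = A q - massL (A q) • q)
    (hUbar : 0 < Ubar) (hLU : 0 < LU)
    (hUb : ∀ (x : Ω) (p : E), 0 ≤ U x p ∧ U x p ≤ Ubar)
    (hULip : ∀ (x : Ω) (p q : E), |U x p - U x q| ≤ LU * ‖p - q‖) (R : ℝ) (q r : E)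
    (hq : ‖q‖ ≤ R) (hr : ‖r‖ ≤ R) :
    ‖G q - G r‖ ≤ ((Ubar + LU * R) * (1 + R) + Ubar * R) * ‖q - r‖ := by
  have hR : 0 ≤ R := (norm_nonneg q).trans hq
  have h1 : ‖A q - A r‖ ≤ (Ubar + LU * R) * ‖q - r‖ :=
    (A_lip hA hUbar hLU hUb hULip q r).trans (by gcongr)
  have h2 : |massL (A q)| ≤ Ubar * R :=
    (abs_massL_le _).trans ((norm_A_le hA hUb q).trans (by gcongr))
  have h3 : |massL (A q - A r)| ≤ (Ubar + LU * R) * ‖q - r‖ := (abs_massL_le _).trans h1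
  have e : G q - G r = (A q - A r) - (massL (A q) • (q - r) + massL (A q - A r) • r) := by
    rw [hGA, hGA, map_sub, smul_sub, sub_smul]; abel
  rw [e]
  refine (norm_sub_le _ _).trans ?_
  have h4 := norm_add_le (massL (A q) • (q - r)) (massL (A q - A r) • r)
  rw [norm_smul, norm_smul, Real.norm_eq_abs, Real.norm_eq_abs] at h4
  have h5 : |massL (A q)| * ‖q - r‖ ≤ Ubar * R * ‖q - r‖ := by gcongr
  have h6 : |massL (A q - A r)| * ‖r‖ ≤ (Ubar + LU * R) * ‖q - r‖ * R := by gcongr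
  nlinarith

theorem step_mem {G : E → E} (hGA : ∀ q, G q = A q - massL (A q) • q) (hUbar : 0 < Ubar)
    (hUb : ∀ (x : Ω) (p : E), 0 ≤ U x p ∧ U x p ≤ Ubar) {q : E} (hq : q ∈ densSet) :
    q + Ubar⁻¹ • G q ∈ densSet := by
  have hA0 : 0 ≤ A q := by
    rw [← Lp.coeFn_nonneg]
    filter_upwards [hA q, (Lp.coeFn_nonneg q).2 hq.1] with x h1 h2
    rw [h1]
    exact mul_nonneg (hUb x q).1 h2
  have hm : massL (A q) ≤ Ubar := by
    have := (abs_massL_le _).trans (norm_A_le hA hUb q)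
    rw [norm_eq_massL hq.1, hq.2, mul_one] at this
    exact (le_abs_self _).trans this
  have e : q + Ubar⁻¹ • G q = (1 - Ubar⁻¹ * massL (A q)) • q + Ubar⁻¹ • A q := by
    rw [hGA, smul_sub, sub_smul, one_smul, smul_smul]; abel
  constructor
  · rw [e]
    have : Ubar⁻¹ * massL (A q) ≤ 1 := by
      rw [inv_mul_le_iff₀ hUbar]; linarith
    exact add_nonneg (smulE_nonneg (by linarith) hq.1) (smulE_nonneg (by positivity) hA0)
  · rw [e]
    simp [hq.2]

end field


/-- **Proposition 1 in density form (exchangeable case): well-posedness of the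
replicator dynamic (10).** Here `G : E → E` is the replicator vector field,
characterized λ-a.e. by `G(q)(x) = (U(x,q) − ∫ U(z,q) q(z) dz) q(x)`. For every
probability density initial datum `p₀` and every horizon `T > 0` there is a
unique continuous solution curve on `[0,T]`, and it stays a probability
density. -/
theorem stmt17
    (Ubar LU : ℝ) (hUbar : 0 < Ubar) (hLU : 0 < LU)
    (U : Ω → E → ℝ)
    (hUb : ∀ (x : Ω) (p : E), 0 ≤ U x p ∧ U x p ≤ Ubar)
    (hULip : ∀ (x : Ω) (p q : E), |U x p - U x q| ≤ LU * ‖p - q‖)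
    (hUm : ∀ p : E, Measurable fun x => U x p)
    (G : E → E)
    (hG : ∀ q : E, ∀ᵐ x ∂(volume : Measure Ω),
      (G q : Ω → ℝ) x = (U x q - ∫ z, U z q * (q : Ω → ℝ) z ∂(volume : Measure Ω)) *
        (q : Ω → ℝ) x)
    (p₀ : E)
    (hp₀pos : ∀ᵐ x ∂(volume : Measure Ω), 0 ≤ (p₀ : Ω → ℝ) x)
    (hp₀int : ∫ x, (p₀ : Ω → ℝ) x ∂(volume : Measure Ω) = 1)
    (T : ℝ) (hT : 0 < T) :
    (∃ p : ℝ → E,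
      p 0 = p₀ ∧ ContinuousOn p (Set.Icc 0 T) ∧
      (∀ t ∈ Set.Icc (0:ℝ) T, HasDerivWithinAt p (G (p t)) (Set.Icc 0 T) t) ∧
      (∀ t ∈ Set.Icc (0:ℝ) T,
        (∀ᵐ x ∂(volume : Measure Ω), 0 ≤ (p t : Ω → ℝ) x) ∧
        ∫ x, (p t : Ω → ℝ) x ∂(volume : Measure Ω) = 1)) ∧
    (∀ p₁ p₂ : ℝ → E,
      (p₁ 0 = p₀ ∧ ContinuousOn p₁ (Set.Icc 0 T) ∧
        ∀ t ∈ Set.Icc (0:ℝ) T, HasDerivWithinAt p₁ (G (p₁ t)) (Set.Icc 0 T) t) →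
      (p₂ 0 = p₀ ∧ ContinuousOn p₂ (Set.Icc 0 T) ∧
        ∀ t ∈ Set.Icc (0:ℝ) T, HasDerivWithinAt p₂ (G (p₂ t)) (Set.Icc 0 T) t) →
      ∀ t ∈ Set.Icc (0:ℝ) T, p₁ t = p₂ t) := by
  obtain ⟨A, hA⟩ := exists_A hUb hUm
  have hGA := G_eq hA hG
  constructor
  · let Φ : E → E := fun q => ret q + Ubar⁻¹ • G (ret q)
    have hΦD : ∀ q, Φ q ∈ densSet := fun q => step_mem hA hGA hUbar hUb (ret_mem q)
    have hn1 : ∀ q ∈ densSet, ‖q‖ = 1 := fun q hq => by rw [norm_eq_massL hq.1, hq.2]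
    let C : ℝ := (Ubar + LU * 1) * (1 + 1) + Ubar * 1
    have hC : 0 ≤ C := by positivity
    let K : NNReal := ⟨(1 + Ubar⁻¹ * C) * 3, by positivity⟩
    have hΦL : LipschitzWith K Φ := by
      apply LipschitzWith.of_dist_le_mul
      intro q r
      rw [dist_eq_norm, dist_eq_norm]
      change _ ≤ (1 + Ubar⁻¹ * C) * 3 * ‖q - r‖
      have h1 := ret_lip q r
      have h2 : ‖G (ret q) - G (ret r)‖ ≤ C * ‖ret q - ret r‖ :=
        G_lip hA hGA hUbar hLU hUb hULip 1 (ret q) (ret r)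
          (hn1 _ (ret_mem q)).le (hn1 _ (ret_mem r)).le
      have e : Φ q - Φ r = (ret q - ret r) + Ubar⁻¹ • (G (ret q) - G (ret r)) := by
        simp only [Φ, smul_sub]; abel
      have hi : 0 < Ubar⁻¹ := inv_pos.2 hUbar
      rw [e]
      refine (norm_add_le _ _).trans ?_
      rw [norm_smul, Real.norm_of_nonneg hi.le]
      calc ‖ret q - ret r‖ + Ubar⁻¹ * ‖G (ret q) - G (ret r)‖
          ≤ ‖ret q - ret r‖ + Ubar⁻¹ * (C * ‖ret q - ret r‖) := by gcongr
        _ = (1 + Ubar⁻¹ * C) * ‖ret q - ret r‖ := by ring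
        _ ≤ (1 + Ubar⁻¹ * C) * (3 * ‖q - r‖) := by gcongr
        _ = _ := by ring
    have hp₀D : p₀ ∈ densSet := ⟨(Lp.coeFn_nonneg p₀).1 hp₀pos, by rw [massL_apply, hp₀int]⟩
    obtain ⟨p, hp0, hp⟩ := relax_exists Φ K 1 hΦL (fun q => by simp [hn1 _ (hΦD q)])
      Ubar hUbar p₀ T hT
    have hpD := relax_mem densSet convex_densSet isClosed_densSet Φ hΦD Ubar hUbar T p
      (by rw [hp0]; exact hp₀D) hp
    refine ⟨p, hp0, fun t ht => (hp t ht).continuousWithinAt, fun t ht => ?_, fun t ht => ?_⟩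
    · refine (hp t ht).congr_deriv ?_
      simp only [Φ, ret_of_mem (hpD t ht), add_sub_cancel_left]
      rw [smul_smul, mul_inv_cancel₀ hUbar.ne', one_smul]
    · exact ⟨(Lp.coeFn_nonneg (p t)).2 (hpD t ht).1, by rw [← massL_apply]; exact (hpD t ht).2⟩
  · rintro p₁ p₂ ⟨h10, h1c, h1d⟩ ⟨h20, h2c, h2d⟩
    obtain ⟨R₁, hR₁⟩ := isCompact_Icc.exists_bound_of_continuousOn h1c
    obtain ⟨R₂, hR₂⟩ := isCompact_Icc.exists_bound_of_continuousOn h2c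
    have hR0 : 0 ≤ max R₁ R₂ :=
      ((norm_nonneg _).trans (hR₁ 0 ⟨le_rfl, hT.le⟩)).trans (le_max_left _ _)
    set R := max R₁ R₂
    let K : NNReal := ⟨(Ubar + LU * R) * (1 + R) + Ubar * R, by positivity⟩
    have hder : ∀ p : ℝ → E,
        (∀ t ∈ Set.Icc (0:ℝ) T, HasDerivWithinAt p (G (p t)) (Set.Icc 0 T) t) →
        ∀ t ∈ Set.Ico (0:ℝ) T, HasDerivWithinAt p (G (p t)) (Set.Ici t) t := by
      intro p hp t ht
      refine (hp t ⟨ht.1, ht.2.le⟩).mono_of_mem_nhdsWithin ?_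
      exact Filter.mem_of_superset (Icc_mem_nhdsGE ht.2) (Set.Icc_subset_Icc_left ht.1)
    refine ODE_solution_unique_of_mem_Icc_right (v := fun _ => G) (K := K)
      (s := fun _ => Metric.closedBall 0 R) ?_ h1c (hder p₁ h1d) ?_ h2c (hder p₂ h2d) ?_
      (h10.trans h20.symm)
    · intro t _
      apply LipschitzOnWith.of_dist_le_mul
      intro q hq r hr
      rw [dist_eq_norm, dist_eq_norm]
      exact G_lip hA hGA hUbar hLU hUb hULip R q r (by simpa using hq) (by simpa using hr)
    · intro t ht
      exact mem_closedBall_zero_iff.2 <| (hR₁ t ⟨ht.1, ht.2.le⟩).trans (le_max_left R₁ R₂)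
    · intro t ht
      exact mem_closedBall_zero_iff.2 <| (hR₂ t ⟨ht.1, ht.2.le⟩).trans (le_max_right R₁ R₂)
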